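/- For all integers n ≥ 0 and k ≥ 1, one has (−1)^{k} ( Q(n) + 2 Σ_{j=1}^{k} (−1)^j Q(n − 2j²) − ε(n) ) ≥ 0, where ε(n) = (−1)^{T_{⌊m/2⌋}} if n = G_m for some (necessarily unique) integer m ≥ 0 and ε(n) = 0 otherwise; moreover the inequality is strict if and only if n ≥ 2(k+1)². -/

import Mathlib

/-- The `n`-th triangular number `T n = n(n+1)/2`. -/
def T (n : ℕ) : ℕ := n * (n + 1) / 2

/-- The `n`-th generalized pentagonal number `G n = T n - T ⌊n/2⌋`. -/
def G (n : ℕ) : ℕ := T n - T (n / 2)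

/-- The number of partitions of `n` into distinct parts, vanishing on negative integers. -/
def Q (n : ℤ) : ℤ :=
  if 0 ≤ n then ((Nat.Partition.distincts n.toNat).card : ℤ) else 0

open Classical in
/-- `ε(n) = (-1)^(T ⌊m/2⌋)` if `n = G m` for the (unique) `m`, and `0` otherwise. -/
noncomputable def eps (n : ℕ) : ℤ := if h : ∃ m, n = G m then (-1) ^ (T (h.choose / 2)) else 0

open Finset PowerSeries

section GaussTheta

variable {R : Type*} [CommRing R]

/-- The sum of Shanks in the finite form of the Gauss theta identity, truncated after `m` terms. -/
def shanksSum (x : R) (n m : ℕ) : R :=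
  ∏ i ∈ range n, (1 - x ^ (i + 1)) + 2 * ∑ t ∈ range m, (-1) ^ (t + 1) * x ^ ((t + 1) * (n + 1)) *
    (∏ i ∈ range t, (1 + x ^ (i + 1))) * ∏ i ∈ Ico (t + 1) n, (1 - x ^ (i + 1))

theorem shanksSum_succ_left (x : R) {n m : ℕ} (hm : m ≤ n) :
    shanksSum x (n + 1) m = (1 + x ^ (n + 1)) * shanksSum x n m +
      2 * (-1) ^ (m + 1) * x ^ ((m + 1) * (n + 1)) * (∏ i ∈ range m, (1 + x ^ (i + 1))) *
        ∏ i ∈ Ico m n, (1 - x ^ (i + 1)) := by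
  induction m with
  | zero =>
    simp only [shanksSum, prod_range_succ, range_zero, sum_empty, prod_empty, ← range_eq_Ico]
    ring
  | succ m ih =>
    have hs (n : ℕ) : shanksSum x n (m + 1) = shanksSum x n m +
        2 * ((-1) ^ (m + 1) * x ^ ((m + 1) * (n + 1)) *
        (∏ i ∈ range m, (1 + x ^ (i + 1))) * ∏ i ∈ Ico (m + 1) n, (1 - x ^ (i + 1))) := by
      simp only [shanksSum, sum_range_succ]
      ring
    rw [hs, hs, ih (by omega), prod_Ico_succ_top (by omega), prod_range_succ,
      prod_eq_prod_Ico_succ_bot (show m < n by omega)]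
    ring

/-- The finite form, due to Shanks, of the Gauss theta identity. -/
theorem prod_one_add_mul_theta_eq_shanksSum (x : R) (n : ℕ) :
    (∏ i ∈ range n, (1 + x ^ (i + 1))) * (1 + 2 * ∑ j ∈ Icc 1 n, (-1) ^ j * x ^ j ^ 2) =
      shanksSum x n n := by
  induction n with
  | zero => simp [shanksSum]
  | succ n ih =>
    have hs : shanksSum x (n + 1) (n + 1) = shanksSum x (n + 1) n +
        2 * ((-1) ^ (n + 1) * x ^ ((n + 1) * (n + 2)) * (∏ i ∈ range n, (1 + x ^ (i + 1)))) := by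
      simp only [shanksSum, sum_range_succ, Ico_self, prod_empty]
      ring
    rw [hs, shanksSum_succ_left x le_rfl, ← ih, sum_Icc_succ_top (by omega), prod_range_succ]
    simp only [Ico_self, prod_empty]
    ring

theorem pow_dvd_prod_one_add_mul_theta_sub (x : R) (n : ℕ) :
    x ^ (n + 1) ∣ (∏ i ∈ range n, (1 + x ^ (i + 1))) *
      (1 + 2 * ∑ j ∈ Icc 1 n, (-1) ^ j * x ^ j ^ 2) - ∏ i ∈ range n, (1 - x ^ (i + 1)) := by
  rw [prod_one_add_mul_theta_eq_shanksSum, shanksSum, add_sub_cancel_left]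
  refine Dvd.dvd.mul_left (dvd_sum fun t _ ↦ ?_) _
  refine Dvd.dvd.mul_right (Dvd.dvd.mul_right (Dvd.dvd.mul_left ?_ _) _) _
  exact pow_dvd_pow x (by nlinarith)

theorem prod_range_two_mul {M : Type*} [CommMonoid M] (f : ℕ → M) (n : ℕ) :
    ∏ i ∈ range (2 * n), f i =
      (∏ i ∈ range n, f (2 * i)) * ∏ i ∈ range n, f (2 * i + 1) := by
  induction n with
  | zero => simp
  | succ n ih =>
    rw [Nat.mul_succ, prod_range_succ, prod_range_succ, ih, prod_range_succ, prod_range_succ]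
    ac_rfl

theorem pow_dvd_prod_one_add_mul_theta_sq_sub (x : R) (n : ℕ) :
    x ^ (2 * n + 2) ∣ (∏ i ∈ range (2 * n), (1 + x ^ (i + 1))) *
      (1 + 2 * ∑ j ∈ Icc 1 n, (-1) ^ j * x ^ (2 * j ^ 2)) -
        ∏ i ∈ range (2 * n), (1 - (-x) ^ (i + 1)) := by
  have h := pow_dvd_prod_one_add_mul_theta_sub (x ^ 2) n
  rw [← pow_mul, show 2 * (n + 1) = 2 * n + 2 by ring] at h
  refine (h.mul_left (∏ i ∈ range n, (1 + x ^ (2 * i + 1)))).trans (dvd_of_eq ?_)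
  have hodd : ∏ i ∈ range n, (1 - (-x) ^ (2 * i + 1)) = ∏ i ∈ range n, (1 + x ^ (2 * i + 1)) :=
    prod_congr rfl fun i _ ↦ by rw [Odd.neg_pow (by simp)]; ring
  have heven : ∏ i ∈ range n, (1 - (-x) ^ (2 * i + 1 + 1)) =
      ∏ i ∈ range n, (1 - (x ^ 2) ^ (i + 1)) :=
    prod_congr rfl fun i _ ↦ by rw [Even.neg_pow (by grind)]; ring
  have heven' : ∏ i ∈ range n, (1 + x ^ (2 * i + 1 + 1)) =
      ∏ i ∈ range n, (1 + (x ^ 2) ^ (i + 1)) :=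
    prod_congr rfl fun i _ ↦ by ring
  rw [prod_range_two_mul, prod_range_two_mul, hodd, heven, heven']
  simp only [← pow_mul]
  ring

end GaussTheta

/-! ### Strict growth of the number of partitions into distinct parts -/

/-- The finite sets of positive integers with sum `n`. -/
def distinctSets (n : ℕ) : Finset (Finset ℕ) := {s ∈ (Icc 1 n).powerset | ∑ i ∈ s, i = n}

theorem mem_distinctSets {n : ℕ} {s : Finset ℕ} :
    s ∈ distinctSets n ↔ 0 ∉ s ∧ ∑ i ∈ s, i = n := by
  simp only [distinctSets, mem_filter, mem_powerset, and_congr_left_iff]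
  rintro rfl
  refine ⟨fun h h0 ↦ by simpa using h h0, fun h i hi ↦ mem_Icc.2 ⟨?_, ?_⟩⟩
  · exact Nat.one_le_iff_ne_zero.2 fun h0 ↦ h (h0 ▸ hi)
  · exact single_le_sum (f := fun i ↦ i) (fun _ _ ↦ Nat.zero_le _) hi

theorem card_distincts_eq_card_distinctSets (n : ℕ) :
    (Nat.Partition.distincts n).card = (distinctSets n).card := by
  refine card_bij (fun p _ ↦ p.parts.toFinset) ?_ ?_ ?_
  · intro p hp
    have hp : p.parts.Nodup := by simpa [Nat.Partition.distincts] using hp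
    refine mem_distinctSets.2 ⟨fun h ↦ ?_, ?_⟩
    · exact (p.parts_pos (Multiset.mem_toFinset.1 h)).ne rfl
    · rw [Finset.sum, Multiset.toFinset_val, hp.dedup, Multiset.map_id', p.parts_sum]
  · intro p hp q hq h
    have hp : p.parts.Nodup := by simpa [Nat.Partition.distincts] using hp
    have hq : q.parts.Nodup := by simpa [Nat.Partition.distincts] using hq
    have := congrArg Finset.val h
    simp only [Multiset.toFinset_val, hp.dedup, hq.dedup] at this
    exact Nat.Partition.ext this
  · intro s hs
    obtain ⟨h0, hsum⟩ := mem_distinctSets.1 hs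
    refine ⟨⟨s.val, fun {i} hi ↦ Nat.pos_of_ne_zero fun h ↦ h0 (h ▸ hi), ?_⟩, ?_, ?_⟩
    · rw [← hsum, Finset.sum, Multiset.map_id']
    · simpa [Nat.Partition.distincts] using s.nodup
    · simp

/-- Adds `d` to the largest element of `s`. -/
def raiseSup (d : ℕ) (s : Finset ℕ) : Finset ℕ := insert (s.sup id + d) (s.erase (s.sup id))

theorem le_sup_of_mem {s : Finset ℕ} {i : ℕ} (hi : i ∈ s) : i ≤ s.sup id := le_sup (f := id) hi

theorem lt_sup_of_mem_erase {s : Finset ℕ} {i : ℕ} (hi : i ∈ s.erase (s.sup id)) :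
    i < s.sup id :=
  lt_of_le_of_ne (le_sup_of_mem (mem_of_mem_erase hi)) (ne_of_mem_erase hi)

theorem sup_add_notMem_erase (d : ℕ) (s : Finset ℕ) : s.sup id + d ∉ s.erase (s.sup id) :=
  fun h ↦ by have := lt_sup_of_mem_erase h; omega

theorem sup_mem {s : Finset ℕ} (hs : s.Nonempty) : s.sup id ∈ s := by
  obtain ⟨i, hi, h⟩ := exists_mem_eq_sup s hs id
  rw [h]
  exact hi

theorem sup_raiseSup (d : ℕ) (s : Finset ℕ) : (raiseSup d s).sup id = s.sup id + d := by
  rw [raiseSup, sup_insert, id, sup_eq_left, Finset.sup_le_iff]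
  exact fun i hi ↦ by have := lt_sup_of_mem_erase hi; simp only [id]; omega

theorem raiseSup_mem_distinctSets {n d : ℕ} (hd : 0 < d) {s : Finset ℕ} (hs : s ∈ distinctSets n) :
    raiseSup d s ∈ distinctSets (n + d) := by
  obtain ⟨h0, hsum⟩ := mem_distinctSets.1 hs
  refine mem_distinctSets.2 ⟨?_, ?_⟩
  · simp only [raiseSup, mem_insert, mem_erase]
    grind
  · rw [raiseSup, sum_insert (sup_add_notMem_erase d s)]
    rcases s.eq_empty_or_nonempty with rfl | hne
    · simp at hsum ⊢
      omega
    · have := add_sum_erase s (fun i ↦ i) (sup_mem hne)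
      omega

theorem raiseSup_injOn (n d : ℕ) : Set.InjOn (raiseSup d) (distinctSets n) := by
  intro s hs t ht h
  have h0s := (mem_distinctSets.1 (mem_coe.1 hs)).1
  have h0t := (mem_distinctSets.1 (mem_coe.1 ht)).1
  have hsup : s.sup id = t.sup id := by
    have := congrArg (fun u ↦ u.sup id) h
    simpa [sup_raiseSup] using this
  have herase : s.erase (s.sup id) = t.erase (t.sup id) := by
    rw [← erase_insert (sup_add_notMem_erase d s), ← erase_insert (sup_add_notMem_erase d t)]
    change (raiseSup d s).erase _ = (raiseSup d t).erase _
    rw [h, hsup]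
  rcases s.eq_empty_or_nonempty with rfl | hs'
  · rcases t.eq_empty_or_nonempty with rfl | ht'
    · rfl
    · have := sup_mem ht'
      rw [← hsup] at this
      exact absurd this h0t
  · rcases t.eq_empty_or_nonempty with rfl | ht'
    · have := sup_mem hs'
      rw [hsup] at this
      exact absurd this h0s
    · rw [← insert_erase (sup_mem hs'), ← insert_erase (sup_mem ht'), herase, hsup]

theorem raiseSup_ne_pair {d a b : ℕ} (ha : a < b) (hb : b < a + d) (s : Finset ℕ) :
    raiseSup d s ≠ {a, b} := by
  intro h
  have hsup := sup_raiseSup d s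
  have hmem : a ∈ raiseSup d s := by simp [h]
  rw [h] at hsup
  simp only [sup_insert, id, sup_singleton] at hsup
  rw [sup_eq_right.2 ha.le] at hsup
  rw [raiseSup, mem_insert] at hmem
  rcases hmem with hmem | hmem
  · omega
  · have := lt_sup_of_mem_erase hmem
    omega

theorem card_distinctSets_lt {n d : ℕ} (hd : 3 ≤ d) :
    (distinctSets n).card < (distinctSets (n + d)).card := by
  obtain ⟨a, b, ha, hab, hb, hsum⟩ : ∃ a b, 0 < a ∧ a < b ∧ b < a + d ∧ a + b = n + d := by
    rcases Nat.even_or_odd' (n + d) with ⟨c, hc | hc⟩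
    · exact ⟨c - 1, c + 1, by omega, by omega, by omega, by omega⟩
    · exact ⟨c, c + 1, by omega, by omega, by omega, by omega⟩
  rw [← card_image_of_injOn (raiseSup_injOn n d)]
  refine card_lt_card (Finset.ssubset_iff_subset_ne.2 ⟨?_, fun h ↦ ?_⟩)
  · exact image_subset_iff.2 fun s hs ↦ raiseSup_mem_distinctSets (by omega) hs
  · have hmem : {a, b} ∈ distinctSets (n + d) :=
      mem_distinctSets.2 ⟨by simp; omega, by rw [sum_pair hab.ne]; exact hsum⟩
    rw [← h] at hmem
    obtain ⟨s, -, hs⟩ := mem_image.1 hmem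
    exact raiseSup_ne_pair hab hb s hs

theorem distinctSets_card_pos (n : ℕ) : 0 < (distinctSets n).card := by
  refine card_pos.2 ⟨({n} : Finset ℕ).erase 0, mem_distinctSets.2 ⟨by simp, ?_⟩⟩
  rcases Nat.eq_zero_or_pos n with rfl | h
  · simp
  · rw [erase_eq_of_notMem (by simp; omega), sum_singleton]

theorem Q_natCast (n : ℕ) : Q n = (Nat.Partition.distincts n).card := by simp [Q]

theorem Q_of_neg {a : ℤ} (ha : a < 0) : Q a = 0 := by simp [Q, ha]

theorem Q_lt_Q {a b : ℤ} (hab : a + 3 ≤ b) (hb : 0 ≤ b) : Q a < Q b := by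
  lift b to ℕ using hb
  rcases lt_or_ge a 0 with ha | ha
  · rw [Q_of_neg ha, Q_natCast, card_distincts_eq_card_distinctSets]
    exact_mod_cast distinctSets_card_pos b
  · lift a to ℕ using ha
    obtain ⟨d, rfl⟩ : ∃ d, b = a + d := ⟨b - a, by omega⟩
    rw [Q_natCast, Q_natCast, card_distincts_eq_card_distinctSets,
      card_distincts_eq_card_distinctSets]
    exact_mod_cast card_distinctSets_lt (by omega)

theorem Q_nonneg (a : ℤ) : 0 ≤ Q a := by
  unfold Q
  split_ifs <;> simp

/-! ### The alternating tail -/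

theorem alternating_Q_bounds (n : ℤ) {m : ℕ} (hm : 1 ≤ m) (L : ℕ) :
    0 ≤ ∑ i ∈ range L, (-1 : ℤ) ^ i * Q (n - 2 * ((m + i : ℕ) : ℤ) ^ 2) ∧
    ∑ i ∈ range L, (-1 : ℤ) ^ i * Q (n - 2 * ((m + i : ℕ) : ℤ) ^ 2) ≤ Q (n - 2 * (m : ℤ) ^ 2) ∧
    (2 * (m : ℤ) ^ 2 ≤ n → 0 < L →
      0 < ∑ i ∈ range L, (-1 : ℤ) ^ i * Q (n - 2 * ((m + i : ℕ) : ℤ) ^ 2)) := by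
  induction L generalizing m with
  | zero => simpa using Q_nonneg _
  | succ L ih =>
    have hgap : n - 2 * ((m + 1 : ℕ) : ℤ) ^ 2 + 3 ≤ n - 2 * (m : ℤ) ^ 2 := by
      push_cast
      nlinarith
    have hlt (h : 2 * (m : ℤ) ^ 2 ≤ n) :
        Q (n - 2 * ((m + 1 : ℕ) : ℤ) ^ 2) < Q (n - 2 * (m : ℤ) ^ 2) := Q_lt_Q hgap (by omega)
    have hle : Q (n - 2 * ((m + 1 : ℕ) : ℤ) ^ 2) ≤ Q (n - 2 * (m : ℤ) ^ 2) := by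
      rcases le_or_gt (2 * (m : ℤ) ^ 2) n with h | h
      · exact (hlt h).le
      · rw [Q_of_neg (by omega)]
        exact Q_nonneg _
    have hsum : ∑ i ∈ range (L + 1), (-1 : ℤ) ^ i * Q (n - 2 * ((m + i : ℕ) : ℤ) ^ 2) =
        Q (n - 2 * (m : ℤ) ^ 2) -
          ∑ i ∈ range L, (-1 : ℤ) ^ i * Q (n - 2 * ((m + 1 + i : ℕ) : ℤ) ^ 2) := by
      rw [sum_range_succ', sub_eq_neg_add (Q _), ← sum_neg_distrib]
      congr 1
      · refine sum_congr rfl fun i _ ↦ ?_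
        rw [pow_succ, show m + (i + 1) = m + 1 + i by ring]
        ring
      · simp
    obtain ⟨h0, h1, -⟩ := ih (m := m + 1) (by omega)
    rw [hsum]
    refine ⟨by omega, by omega, fun h _ ↦ ?_⟩
    have := hlt h
    omega

/-! ### The generating function identity -/

open scoped PowerSeries.WithPiTopology in
theorem eventually_coeff_prod_one_add (n : ℕ) :
    ∀ᶠ N in Filter.atTop, ∀ m ≤ n,
      coeff m (∏ i ∈ range N, (1 + X ^ (i + 1) : ℤ⟦X⟧)) = Q m := by
  have hev (m : ℕ) : ∀ᶠ N in Filter.atTop,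
      coeff m (∏ i ∈ range N, (1 + X ^ (i + 1) : ℤ⟦X⟧)) = Q m := by
    let : TopologicalSpace ℤ := ⊥
    have : DiscreteTopology ℤ := ⟨rfl⟩
    have h := (Nat.Partition.hasProd_powerSeriesMk_card_countRestricted ℤ two_pos).tendsto_prod_nat
    rw [WithPiTopology.tendsto_iff_coeff_tendsto] at h
    have h := h m
    have hterm (i : ℕ) : ∑ j ∈ range 2, (X : ℤ⟦X⟧) ^ ((i + 1) * j) = 1 + X ^ (i + 1) := by
      simp [sum_range_succ]
    simp_rw [hterm] at h
    simpa [Nat.Partition.countRestricted_two, Q_natCast] using h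
  have := (Filter.eventually_all_finset (Iic n)).2 fun m _ ↦ hev m
  simpa using this

theorem eventually_coeff_prod_one_sub_neg (n : ℕ) :
    ∀ᶠ N in Filter.atTop, coeff n (∏ i ∈ range N, (1 - (-X) ^ (i + 1) : ℤ⟦X⟧)) =
      (-1) ^ n * (pentagonalSeries ℤ).coeff n := by
  have h := Filter.tendsto_finset_range.eventually (coeff_prod_one_sub_X_pow_eventually_eq ℤ n)
  filter_upwards [h] with N hN
  rw [← hN, ← coeff_rescale]
  change _ = coeff n (evalNegHom _)
  simp [map_prod]

theorem eventually_theta_identity (n : ℕ) :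
    ∀ᶠ N : ℕ in Filter.atTop,
      Q (n : ℤ) + 2 * ∑ j ∈ Icc 1 N, (-1 : ℤ) ^ j * Q ((n : ℤ) - 2 * (j : ℤ) ^ 2) =
        (-1) ^ n * (pentagonalSeries ℤ).coeff n := by
  have htwo : Filter.Tendsto (fun N : ℕ ↦ 2 * N) Filter.atTop Filter.atTop :=
    Filter.tendsto_id.const_mul_atTop' two_pos
  filter_upwards [htwo.eventually (eventually_coeff_prod_one_add n),
    htwo.eventually (eventually_coeff_prod_one_sub_neg n), Filter.eventually_ge_atTop n]
    with N hadd hsub hN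
  have hdvd := X_pow_dvd_iff.1 (pow_dvd_prod_one_add_mul_theta_sq_sub (X : ℤ⟦X⟧) N) n (by omega)
  rw [map_sub, hsub, sub_eq_zero] at hdvd
  rw [← hdvd, mul_add, mul_one, map_add, hadd n le_rfl, mul_left_comm,
    show (2 : ℤ⟦X⟧) = C 2 by simp, coeff_C_mul, mul_sum _ _ (∏ i ∈ _, _), map_sum]
  congr 2
  refine sum_congr rfl fun j _ ↦ ?_
  rw [mul_left_comm, show ((-1 : ℤ⟦X⟧)) ^ j = C ((-1) ^ j) by simp, coeff_C_mul, coeff_mul_X_pow']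
  congr 1
  split_ifs with h
  · rw [hadd _ (by omega)]
    congr 1
    push_cast [Nat.cast_sub h]
    ring
  · rw [Q_of_neg]
    have : (n : ℤ) < ((2 * j ^ 2 : ℕ) : ℤ) := by exact_mod_cast not_le.1 h
    push_cast at this
    omega

theorem two_mul_T (n : ℕ) : 2 * T n = n * (n + 1) :=
  Nat.mul_div_cancel' (Nat.even_mul_succ_self n).two_dvd

theorem G_two_mul (a : ℕ) : G (2 * a) = pentagonal (-a) := by
  have h1 := two_mul_T (2 * a)
  have h2 := two_mul_T a
  have h3 := two_mul_natCast_pentagonal_neg a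
  rw [G, Nat.mul_div_cancel_left _ two_pos]
  zify at h1 h2
  have h4 : (T (2 * a) : ℤ) = T a + pentagonal (-a) := by nlinarith
  omega

theorem G_two_mul_add_one (a : ℕ) : G (2 * a + 1) = pentagonal (a + 1) := by
  have h1 := two_mul_T (2 * a + 1)
  have h2 := two_mul_T a
  have h3 := two_mul_natCast_pentagonal (a + 1)
  rw [G, show (2 * a + 1) / 2 = a by omega]
  zify at h1 h2
  have h4 : (T (2 * a + 1) : ℤ) = T a + pentagonal (a + 1) := by nlinarith
  omega

theorem neg_one_pow_T_half (m : ℕ) :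
    (-1 : ℤ) ^ T (m / 2) = (-1) ^ G m * (pentagonalSeries ℤ).coeff (G m) := by
  have hsign (a : ℕ) : ((Int.negOnePow a : ℤˣ) : ℤ) = (-1) ^ a := by
    simp [Int.negOnePow_def]
  rcases Nat.even_or_odd' m with ⟨a, rfl | rfl⟩
  · rw [G_two_mul, coeff_pentagonalSeries_pentagonal, Nat.mul_div_cancel_left _ two_pos,
      Int.negOnePow_neg, hsign, Int.cast_id, ← pow_add]
    have h : pentagonal (-a) + a = T a + 2 * T a := by
      have h1 := two_mul_T a
      have h2 := two_mul_natCast_pentagonal_neg a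
      zify at h1 ⊢
      nlinarith
    rw [h, pow_add, pow_mul]
    simp
  · rw [G_two_mul_add_one, coeff_pentagonalSeries_pentagonal, show (2 * a + 1) / 2 = a by omega,
      ← Nat.cast_succ, hsign, Int.cast_id, ← pow_add]
    have h : pentagonal (a.succ : ℤ) + a.succ = T a + 2 * T (a + 1) := by
      have h1 := two_mul_T a
      have h2 := two_mul_natCast_pentagonal (a + 1)
      have h3 := two_mul_T (a + 1)
      zify at h1 h3 ⊢
      nlinarith
    rw [h, pow_add, pow_mul]
    simp

theorem eps_eq (n : ℕ) : eps n = (-1) ^ n * (pentagonalSeries ℤ).coeff n := by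
  unfold eps
  split_ifs with h
  · rw [neg_one_pow_T_half, ← h.choose_spec]
  · rw [coeff_pentagonalSeries_eq_zero, mul_zero]
    rintro ⟨k, rfl⟩
    apply h
    rcases le_or_gt k 0 with hk | hk
    · refine ⟨2 * k.natAbs, ?_⟩
      rw [G_two_mul]
      congr 1
      omega
    · refine ⟨2 * (k - 1).natAbs + 1, ?_⟩
      rw [G_two_mul_add_one]
      congr 1
      omega

theorem stmt_4 (n k : ℕ) (hk : 1 ≤ k) :
    0 ≤ (-1 : ℤ) ^ k *
        (Q (n : ℤ) + 2 * ∑ j ∈ Finset.Icc 1 k, (-1 : ℤ) ^ j * Q ((n : ℤ) - 2 * (j : ℤ) ^ 2) - eps n) ∧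
    (0 < (-1 : ℤ) ^ k *
        (Q (n : ℤ) + 2 * ∑ j ∈ Finset.Icc 1 k, (-1 : ℤ) ^ j * Q ((n : ℤ) - 2 * (j : ℤ) ^ 2) - eps n) ↔
      2 * (k + 1) ^ 2 ≤ n) := by
  obtain ⟨N, hN, hkN⟩ :=
    ((eventually_theta_identity n).and (Filter.eventually_ge_atTop (k + 1))).exists
  obtain ⟨L, rfl⟩ := Nat.exists_eq_add_of_le (show k ≤ N by omega)
  have htail : (-1 : ℤ) ^ k * (Q (n : ℤ) +
      2 * ∑ j ∈ Finset.Icc 1 k, (-1 : ℤ) ^ j * Q ((n : ℤ) - 2 * (j : ℤ) ^ 2) - eps n) =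
      2 * ∑ i ∈ range L, (-1 : ℤ) ^ i * Q (n - 2 * ((k + 1 + i : ℕ) : ℤ) ^ 2) := by
    have hsplit : ∑ j ∈ Icc 1 (k + L), (-1 : ℤ) ^ j * Q ((n : ℤ) - 2 * (j : ℤ) ^ 2) =
        ∑ j ∈ Icc 1 k, (-1 : ℤ) ^ j * Q ((n : ℤ) - 2 * (j : ℤ) ^ 2) +
        ∑ i ∈ range L, (-1 : ℤ) ^ (k + 1 + i) * Q (n - 2 * ((k + 1 + i : ℕ) : ℤ) ^ 2) := by
      rw [← Ico_add_one_right_eq_Icc, ← Ico_add_one_right_eq_Icc,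
        ← sum_Ico_consecutive _ (show 1 ≤ k + 1 by omega) (show k + 1 ≤ k + L + 1 by omega),
        sum_Ico_eq_sum_range _ (k + 1), show k + L + 1 - (k + 1) = L by omega]
    have hneg : ∑ i ∈ range L, (-1 : ℤ) ^ (k + 1 + i) * Q (n - 2 * ((k + 1 + i : ℕ) : ℤ) ^ 2) =
        -((-1) ^ k * ∑ i ∈ range L, (-1 : ℤ) ^ i * Q (n - 2 * ((k + 1 + i : ℕ) : ℤ) ^ 2)) := by
      rw [mul_sum, ← sum_neg_distrib]
      exact sum_congr rfl fun i _ ↦ by ring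
    have hsq : (-1 : ℤ) ^ k * (-1) ^ k = 1 := by rw [← mul_pow]; simp
    rw [eps_eq, ← hN, hsplit, hneg]
    linear_combination
      2 * (∑ i ∈ range L, (-1 : ℤ) ^ i * Q (n - 2 * ((k + 1 + i : ℕ) : ℤ) ^ 2)) * hsq
  obtain ⟨h0, h1, h2⟩ := alternating_Q_bounds n (show 1 ≤ k + 1 by omega) L
  rw [htail]
  refine ⟨by omega, fun h ↦ ?_, fun h ↦ ?_⟩
  · by_contra hlt
    have hlt : (n : ℤ) < ((2 * (k + 1) ^ 2 : ℕ) : ℤ) := by exact_mod_cast not_le.1 hlt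
    push_cast at hlt h1
    rw [Q_of_neg (by omega)] at h1
    push_cast at h
    omega
  · have := h2 (by exact_mod_cast h) (by omega)
    omega
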